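/- arXiv:2107.01925 — 4 statements merged into one kernel-verified Lean document; each statement's English description precedes it below -/
import Mathlib

section
/- For all m, n ∈ ℕ with m ≠ n, the subgroups Hₘ and Hₙ of SL₂(k) × SL₂(k) are distinct: Hₘ ≠ Hₙ. -/
theorem iterate_map_frobenius_apply {ι R : Type*} [DecidableEq ι] [Fintype ι] [CommRing R] (p : ℕ)
    [ExpChar R p] (n : ℕ) (g : Matrix.SpecialLinearGroup ι R) (i j : ι) :
    ((⇑(Matrix.SpecialLinearGroup.map (n := ι) (frobenius R p)))^[n] g) i j = g i j ^ p ^ n := by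
  induction n with
  | zero => simp
  | succ n ih =>
    rw [Function.iterate_succ_apply', Matrix.SpecialLinearGroup.map_apply_coe,
      RingHom.mapMatrix_apply, Matrix.map_apply, ih, frobenius_def, ← pow_mul, ← pow_succ]

theorem eq_of_forall_pow_eq_pow {R : Type*} [CommRing R] [IsDomain R] [Infinite R] {a b : ℕ}
    (h : ∀ x : R, x ^ a = x ^ b) : a = b := by
  have hX : (Polynomial.X ^ a : Polynomial R) = Polynomial.X ^ b :=
    Polynomial.funext fun x => by simpa using h x
  simpa using congrArg Polynomial.natDegree hX

/-- With `k` algebraically closed of characteristic `p > 0`,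
`σ` the entrywise Frobenius on `SL₂(k)`, `φ n : g ↦ (g, σⁿ g)` and `H n = range (φ n)`,
the subgroups `H m` and `H n` are distinct for `m ≠ n`. -/
theorem stmt1 {k : Type*} [Field k] [IsAlgClosed k] {p : ℕ} [Fact p.Prime] [CharP k p]
    (φ : ℕ → (Matrix.SpecialLinearGroup (Fin 2) k →*
      Matrix.SpecialLinearGroup (Fin 2) k × Matrix.SpecialLinearGroup (Fin 2) k))
    (hφ : ∀ n g, φ n g = (g, (⇑(Matrix.SpecialLinearGroup.map (n := Fin 2) (frobenius k p)))^[n] g))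
    (H : ℕ → Subgroup (Matrix.SpecialLinearGroup (Fin 2) k × Matrix.SpecialLinearGroup (Fin 2) k))
    (hH : ∀ n, H n = (φ n).range) :
    ∀ m n : ℕ, m ≠ n → H m ≠ H n := by
  intro m n hmn h
  have hp : p.Prime := Fact.out
  refine hmn (Nat.pow_right_injective hp.two_le (eq_of_forall_pow_eq_pow (R := k) fun x => ?_))
  let g : Matrix.SpecialLinearGroup (Fin 2) k := ⟨!![1, x; 0, 1], by simp⟩
  have hg : φ m g ∈ (φ n).range := by
    rw [← hH, ← h, hH]
    exact ⟨g, rfl⟩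
  obtain ⟨g', hg'⟩ := hg
  rw [hφ, hφ, Prod.mk.injEq] at hg'
  obtain ⟨rfl, hσ⟩ := hg'
  have hentry := congrArg (fun A : Matrix.SpecialLinearGroup (Fin 2) k => A 0 1) hσ
  simp only [iterate_map_frobenius_apply] at hentry
  simpa [g] using hentry.symm
end

section
/- Let V be an n-dimensional vector space over a field k with n ≥ 1, and let u ∈ GL(V) be unipotent (i.e., u − 1 is nilpotent). Then rank(u − 1) = n − 1 if and only if there is exactly one complete flag 0 = W₀ ⊂ W₁ ⊂ ⋯ ⊂ Wₙ = V all of whose members are u-invariant (u(Wᵢ) = Wᵢ for all i). -/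
open Module

namespace LinearMap

variable {k V : Type*} [Field k] [AddCommGroup V] [Module k V]

/-- A nilpotent endomorphism has nonzero kernel modulo any proper subspace. -/
theorem exists_notMem_apply_mem_of_isNilpotent {N : V →ₗ[k] V} (hN : IsNilpotent N)
    {W : Submodule k V} (hW : W ≠ ⊤) : ∃ v, v ∉ W ∧ N v ∈ W := by
  classical
  obtain ⟨v, -, hv⟩ := SetLike.exists_of_lt (lt_top_iff_ne_top.2 hW)
  have h : ∃ m, (N ^ m) v ∈ W := by
    obtain ⟨m, hm⟩ := hN
    exact ⟨m, by simp [hm]⟩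
  have hpos : Nat.find h ≠ 0 := by simpa using hv
  obtain ⟨m, hm⟩ := Nat.exists_eq_succ_of_ne_zero hpos
  refine ⟨(N ^ m) v, Nat.find_min h (by omega), ?_⟩
  have hspec := Nat.find_spec h
  rwa [hm, Nat.succ_eq_add_one, pow_succ', Module.End.mul_apply] at hspec

variable [FiniteDimensional k V]

theorem exists_invariant_finrank_succ {N : V →ₗ[k] V} (hN : IsNilpotent N)
    {W : Submodule k V} (hW : W ≠ ⊤) (hinv : W ≤ W.comap N) :
    ∃ W' : Submodule k V, W ≤ W' ∧ W' ≤ W'.comap N ∧ finrank k W' = finrank k W + 1 := by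
  obtain ⟨v, hv, hNv⟩ := exists_notMem_apply_mem_of_isNilpotent hN hW
  refine ⟨W ⊔ k ∙ v, le_sup_left, ?_, Submodule.finrank_sup_span_singleton hv⟩
  refine sup_le (hinv.trans (Submodule.comap_mono le_sup_left)) ?_
  rw [Submodule.span_singleton_le_iff_mem]
  exact Submodule.mem_sup_left hNv

/-- Every line in the kernel of a nilpotent endomorphism extends to an invariant complete flag. -/
theorem exists_invariant_flag {N : V →ₗ[k] V} (hN : IsNilpotent N) {L : Submodule k V}
    (hL : finrank k L = 1) (hLN : L ≤ ker N) :
    ∃ F : ℕ → Submodule k V, Monotone F ∧ F 1 = L ∧ (∀ i ≤ finrank k V, finrank k (F i) = i) ∧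
      ∀ i, F i ≤ (F i).comap N := by
  have key : ∀ W : Submodule k V, ∃ W' : Submodule k V, W ≤ W' ∧
      (W ≤ W.comap N → W' ≤ W'.comap N) ∧ (W ≠ ⊤ → W ≤ W.comap N →
        finrank k W' = finrank k W + 1) := by
    intro W
    by_cases h : W ≠ ⊤ ∧ W ≤ W.comap N
    · obtain ⟨W', h₁, h₂, h₃⟩ := exists_invariant_finrank_succ hN h.1 h.2
      exact ⟨W', h₁, fun _ => h₂, fun _ _ => h₃⟩
    · exact ⟨W, le_rfl, fun h => h, fun h₁ h₂ => (h ⟨h₁, h₂⟩).elim⟩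
  choose e hle hinv hrank using key
  let F : ℕ → Submodule k V := fun i => Nat.casesOn i ⊥ fun j => e^[j] L
  have hsucc : ∀ j, F (j + 1 + 1) = e (F (j + 1)) := fun j =>
    Function.iterate_succ_apply' e j L
  have hFinv : ∀ i, F i ≤ (F i).comap N := by
    intro i
    induction i with
    | zero => exact bot_le
    | succ i ih =>
      cases i with
      | zero =>
        intro x hx
        have : N x = 0 := hLN hx
        simp [this]
      | succ j => rw [hsucc]; exact hinv _ ih
  refine ⟨F, monotone_nat_of_le_succ ?_, rfl, ?_, hFinv⟩
  · rintro (_ | j)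
    · exact bot_le
    · rw [hsucc]; exact hle _
  · intro i
    induction i with
    | zero => intro _; exact finrank_bot k V
    | succ i ih =>
      intro hi
      cases i with
      | zero => exact hL
      | succ j =>
        have hj := ih (by omega)
        have htop : F (j + 1) ≠ ⊤ := by
          intro htop
          rw [htop, finrank_top] at hj
          omega
        rw [hsucc, hrank _ htop (hFinv (j + 1)), hj]

theorem finrank_ker_pow_le (N : V →ₗ[k] V) (i : ℕ) :
    finrank k (ker (N ^ i)) ≤ i * finrank k (ker N) := by
  induction i with
  | zero =>
    have : ker (1 : V →ₗ[k] V) = ⊥ := ker_id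
    simp [this]
  | succ i ih =>
    have hrn := finrank_range_add_finrank_ker (N.domRestrict (ker (N ^ (i + 1))))
    have hr : finrank k (range (N.domRestrict (ker (N ^ (i + 1))))) ≤ finrank k (ker (N ^ i)) := by
      refine Submodule.finrank_mono ?_
      rintro _ ⟨⟨x, hx⟩, rfl⟩
      rwa [mem_ker, pow_succ, Module.End.mul_apply] at hx
    have hk : finrank k (ker (N.domRestrict (ker (N ^ (i + 1))))) ≤ finrank k (ker N) := by
      rw [ker_domRestrict, ← Submodule.finrank_map_subtype_eq]
      exact Submodule.finrank_mono (Submodule.map_comap_le _ _)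
    rw [add_one_mul]
    omega

theorem le_ker_pow_finrank {N : V →ₗ[k] V} (hN : IsNilpotent N) {W : Submodule k V}
    (hW : W ≤ W.comap N) : W ≤ ker (N ^ finrank k W) := by
  have hM : IsNilpotent (N.restrict hW) := by
    obtain ⟨m, hm⟩ := hN
    refine ⟨m, ?_⟩
    ext x
    rw [Module.End.pow_restrict m]
    simp [hm]
  have h0 : N.restrict hW ^ finrank k W = 0 := by
    have := aeval_self_charpoly (N.restrict hW)
    rwa [hM.charpoly_eq_X_pow_finrank, map_pow, Polynomial.aeval_X] at this
  intro x hx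
  have := congrArg Subtype.val (LinearMap.congr_fun h0 ⟨x, hx⟩)
  rw [Module.End.pow_restrict] at this
  exact this

/-- If the kernel of a nilpotent `N` is a line, the invariant subspaces are the kernels of the
powers of `N`. -/
theorem eq_ker_pow_finrank {N : V →ₗ[k] V} (hN : IsNilpotent N) (hker : finrank k (ker N) = 1)
    {W : Submodule k V} (hW : W ≤ W.comap N) : W = ker (N ^ finrank k W) :=
  Submodule.eq_of_le_of_finrank_le (le_ker_pow_finrank hN hW) <| by
    simpa [hker] using finrank_ker_pow_le N (finrank k W)

theorem map_eq_iff_le_comap_sub_one {u : V →ₗ[k] V} (hu : IsNilpotent (u - 1))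
    (W : Submodule k V) : W.map u = W ↔ W ≤ W.comap (u - 1) := by
  constructor
  · intro h x hx
    have : u x ∈ W := h ▸ Submodule.mem_map_of_mem hx
    simpa using W.sub_mem this hx
  · intro h
    have hunit : IsUnit u := by simpa using hu.isUnit_add_one
    have hinj : Function.Injective u := ((Module.End.isUnit_iff u).1 hunit).1
    refine Submodule.eq_of_le_of_finrank_eq ?_ (W.equivMapOfInjective u hinj).finrank_eq.symm
    rintro _ ⟨x, hx, rfl⟩
    have := W.add_mem (h hx) hx
    simpa using this

end LinearMap

/-- Let `V` be an `n`-dimensional vector space (`n ≥ 1`) over a field `k`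
and let `u ∈ GL(V)` be unipotent, i.e. `u - 1` is nilpotent.  Then `rank (u - 1) = n - 1`
(i.e. `u` is regular unipotent) if and only if there is exactly one complete flag
`0 = W₀ ⊂ W₁ ⊂ ⋯ ⊂ Wₙ = V` all of whose members are `u`-invariant. -/
theorem stmt5 {k V : Type*} [Field k] [AddCommGroup V] [Module k V]
    [FiniteDimensional k V] {n : ℕ} (hn : 1 ≤ n) (hV : finrank k V = n)
    (u : V →ₗ[k] V) (hu : IsNilpotent (u - 1)) :
    finrank k (LinearMap.range (u - 1)) = n - 1 ↔
      ∃! W : Fin (n + 1) → Submodule k V,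
        Monotone W ∧ (∀ i : Fin (n + 1), finrank k (W i) = (i : ℕ)) ∧
        (∀ i : Fin (n + 1), (W i).map u = W i) := by
  have hrn := LinearMap.finrank_range_add_finrank_ker (u - 1)
  simp only [LinearMap.map_eq_iff_le_comap_sub_one hu]
  have hflag : ∀ L : Submodule k V, finrank k L = 1 → L ≤ LinearMap.ker (u - 1) →
      ∃ W : Fin (n + 1) → Submodule k V, (Monotone W ∧
        (∀ i : Fin (n + 1), finrank k (W i) = (i : ℕ)) ∧
        (∀ i : Fin (n + 1), W i ≤ (W i).comap (u - 1))) ∧ W ⟨1, by omega⟩ = L := by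
    intro L hL hLN
    obtain ⟨F, hmono, hF1, hrank, hinv⟩ := LinearMap.exists_invariant_flag hu hL hLN
    exact ⟨fun i => F i, ⟨fun i j hij => hmono hij, fun i => hrank i (by omega),
      fun i => hinv i⟩, hF1⟩
  constructor
  · intro hr
    have hker : finrank k (LinearMap.ker (u - 1)) = 1 := by omega
    obtain ⟨W, hW, -⟩ := hflag _ hker le_rfl
    refine ⟨W, hW, fun W' hW' => funext fun i => ?_⟩
    rw [LinearMap.eq_ker_pow_finrank hu hker (hW'.2.2 i),
      LinearMap.eq_ker_pow_finrank hu hker (hW.2.2 i), hW.2.1 i, hW'.2.1 i]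
  · rintro ⟨W, hW, huniq⟩
    have hle : LinearMap.ker (u - 1) ≤ W ⟨1, by omega⟩ := by
      intro v hv
      by_cases hv0 : v = 0
      · simp [hv0]
      obtain ⟨W', hW', hW'1⟩ := hflag (Submodule.span k {v}) (finrank_span_singleton hv0)
        ((Submodule.span_singleton_le_iff_mem _ _).2 hv)
      rw [← huniq W' hW', hW'1]
      exact Submodule.mem_span_singleton_self v
    have hub := Submodule.finrank_mono hle
    rw [hW.2.1] at hub
    have : Nontrivial V := Module.nontrivial_of_finrank_pos (R := k) (by omega)
    obtain ⟨v, hv, hNv⟩ :=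
      LinearMap.exists_notMem_apply_mem_of_isNilpotent hu (bot_ne_top (α := Submodule k V))
    have hpos : 0 < finrank k (LinearMap.ker (u - 1)) := by
      refine Submodule.one_le_finrank_iff.2 fun h => hv ?_
      rw [← h]
      exact hNv
    simp only at hub
    omega
end

section
/- Let V be an n-dimensional vector space over a field k and let e, f : V → V be nilpotent endomorphisms with rank e = rank f = n − 1. Suppose that ker(e^d) ∩ ker(f^{n−d}) = 0 for every integer 0 < d < n. Then the only subspaces U ⊆ V satisfying both e(U) ⊆ U and f(U) ⊆ U are U = 0 and U = V. -/
open Module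

/-- A nonzero subspace invariant under a nilpotent endomorphism contains a nonzero vector of
its kernel. -/
theorem exists_mem_ker_of_isNilpotent_of_invariant {k V : Type*} [Field k] [AddCommGroup V]
    [Module k V] {e : V →ₗ[k] V} (he : IsNilpotent e) {U : Submodule k V}
    (hU : ∀ x ∈ U, e x ∈ U) (hU0 : U ≠ ⊥) : ∃ x ∈ U, x ≠ 0 ∧ e x = 0 := by
  obtain ⟨y, hyU, hy0⟩ := U.exists_mem_ne_zero_of_ne_bot hU0
  by_contra! h
  have hpow (m : ℕ) : (e ^ m) y ∈ U ∧ (e ^ m) y ≠ 0 := by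
    induction m with
    | zero => exact ⟨hyU, hy0⟩
    | succ m ih =>
      rw [pow_succ', Module.End.mul_apply]
      exact ⟨hU _ ih.1, h _ ih.1 ih.2⟩
  obtain ⟨m, hm⟩ := he
  exact (hpow m).2 (by simp [hm])

/-- A `d`-dimensional subspace invariant under a nilpotent endomorphism `f` is killed by `f ^ d`. -/
theorem le_ker_pow_finrank_of_isNilpotent_of_invariant {k V : Type*} [Field k] [AddCommGroup V]
    [Module k V] [FiniteDimensional k V] {f : V →ₗ[k] V} (hf : IsNilpotent f)
    {U : Submodule k V} (hU : ∀ x ∈ U, f x ∈ U) :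
    U ≤ LinearMap.ker (f ^ finrank k U) := by
  intro x hx
  have hnil : IsNilpotent (f.restrict hU) := Module.End.isNilpotent.restrict hU hf
  have h := LinearMap.aeval_self_charpoly (f.restrict hU)
  rw [LinearMap.charpoly_eq_X_pow_iff _ |>.mpr, map_pow, Polynomial.aeval_X,
    Module.End.pow_restrict] at h
  · simpa using congrArg Subtype.val (LinearMap.congr_fun h ⟨x, hx⟩)
  · obtain ⟨m, hm⟩ := hnil
    exact fun y => ⟨m, by simp [hm]⟩



/-- Let `V` be an `n`-dimensional vector space over a field `k` and let
`e, f : V → V` be nilpotent endomorphisms of rank `n - 1` (regular nilpotents).  If their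
invariant complete flags are in opposite position, i.e. `ker (e ^ d) ⊓ ker (f ^ (n - d)) = 0`
for all `0 < d < n`, then the only subspaces invariant under both `e` and `f` are `0` and `V`. -/
theorem stmt7 {k V : Type*} [Field k] [AddCommGroup V] [Module k V]
    [FiniteDimensional k V] {n : ℕ} (hV : finrank k V = n)
    (e f : V →ₗ[k] V) (he : IsNilpotent e) (hf : IsNilpotent f)
    (hre : finrank k (LinearMap.range e) = n - 1)
    (hrf : finrank k (LinearMap.range f) = n - 1)
    (hopp : ∀ d : ℕ, 0 < d → d < n →
      LinearMap.ker (e ^ d) ⊓ LinearMap.ker (f ^ (n - d)) = ⊥) :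
    ∀ U : Submodule k V, (∀ x ∈ U, e x ∈ U) → (∀ x ∈ U, f x ∈ U) →
      U = ⊥ ∨ U = ⊤ := by
  intro U heU hfU
  by_contra! hU
  obtain ⟨x, hxU, hx0, hex⟩ := exists_mem_ker_of_isNilpotent_of_invariant he heU hU.1
  have hlt : finrank k U < n := hV ▸ Submodule.finrank_lt hU.2
  have hpos : 0 < finrank k U := Submodule.one_le_finrank_iff.mpr hU.1
  have hmem : x ∈ LinearMap.ker (e ^ (n - finrank k U)) ⊓
      LinearMap.ker (f ^ (n - (n - finrank k U))) := by
    rw [Nat.sub_sub_self hlt.le]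
    refine ⟨?_, le_ker_pow_finrank_of_isNilpotent_of_invariant hf hfU hxU⟩
    obtain ⟨m, hm⟩ := Nat.exists_eq_succ_of_ne_zero (Nat.sub_pos_of_lt hlt).ne'
    simp [hm, pow_succ, hex]
  rw [hopp _ (Nat.sub_pos_of_lt hlt) (by lia)] at hmem
  exact hx0 (by simpa using hmem)
end

section
/- Let k be a field, n ≥ 2, and let b : Fin n → ℕ be a monotone (weakly increasing) non-constant function. Let U⁺ be the set of matrices of the form 1 + N where N ∈ Mₙ(k) satisfies N i j = 0 whenever ¬(b i < b j), and let U⁻ be the set of matrices of the form 1 + N where N i j = 0 whenever ¬(b j < b i). Then every element of U⁺ ∪ U⁻ is invertible of determinant 1, and the subgroup of GLₙ(k) generated by U⁺ ∪ U⁻ is exactly {g ∈ GLₙ(k) : det g = 1}, i.e., SLₙ(k). -/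
open Matrix

namespace Matrix

section Det

variable {m R : Type*} [LinearOrder m] [Fintype m] [CommRing R]

theorem det_one_add_of_strictly_upper {N : Matrix m m R} (hN : ∀ i j, ¬ i < j → N i j = 0) :
    (1 + N).det = 1 := by
  rw [det_of_isUpperTriangular]
  · exact Finset.prod_eq_one fun i _ => by simp [hN i i (lt_irrefl i)]
  · intro i j (hij : j < i)
    simp [one_apply_ne hij.ne', hN i j hij.not_gt]

theorem det_one_add_of_strictly_lower {N : Matrix m m R} (hN : ∀ i j, ¬ j < i → N i j = 0) :
    (1 + N).det = 1 := by
  rw [← det_transpose, transpose_add, transpose_one]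
  exact det_one_add_of_strictly_upper fun i j h => hN j i h

end Det

namespace SpecialLinearGroup

open scoped commutatorElement

variable {ι : Type*} [Fintype ι] [DecidableEq ι]

theorem transvection_eq_commutator {R : Type*} [CommRing R] {i j l : ι} (hij : i ≠ j)
    (hil : i ≠ l) (hlj : l ≠ j) (c : R) :
    transvection hij c = ⁅transvection hil c, transvection hlj (1 : R)⁆ := by
  rw [commutatorElement_def, eq_mul_inv_iff_mul_eq, eq_mul_inv_iff_mul_eq]
  refine Subtype.ext ?_
  simp only [coe_mul, transvection_coe]
  simp [mul_add, add_mul, hij.symm, hlj.symm]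
  abel

variable {F : Type*} [Field F]

theorem diag2n_eq_transvection_mul {i j : ι} (hij : i ≠ j) {a : F} (ha : a ≠ 0) :
    diag2n hij a ha =
      (transvection hij a * transvection hij.symm (-a⁻¹) * transvection hij a) *
      (transvection hij (-1) * transvection hij.symm 1 * transvection hij (-1)) := by
  have hD : (diag2n hij a ha : Matrix ι ι F) =
      1 + single i i (a - 1) + single j j (a⁻¹ - 1) := by
    rw [diag2n_coe]
    ext x y
    simp only [diagonal_apply, add_apply, one_apply, single_apply]
    grind
  refine Subtype.ext ?_
  rw [hD]
  simp only [coe_mul, transvection_coe]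
  simp [mul_add, add_mul, hij, hij.symm, ha, sub_eq_add_neg, single_add, ← single_neg]
  abel

theorem subgroup_eq_top_of_transvection_mem [Nontrivial ι] {H : Subgroup (SpecialLinearGroup ι F)}
    (hH : ∀ (i j : ι) (hij : i ≠ j) (c : F), transvection hij c ∈ H) : H = ⊤ := by
  refine (Subgroup.eq_top_iff' H).2 fun g => ?_
  refine diagonal_transvection_induction' (· ∈ H) g (fun i j hij c hc => ?_) hH
    fun _ _ => mul_mem
  rw [diag2n_eq_transvection_mul hij hc]
  exact mul_mem (mul_mem (mul_mem (hH ..) (hH ..)) (hH ..))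
    (mul_mem (mul_mem (hH ..) (hH ..)) (hH ..))

/-- A subgroup of `SL` containing every transvection whose two indices lie in different fibres of
a non-constant function is everything. -/
theorem subgroup_eq_top_of_transvection_mem_of_ne {α : Type*} {b : ι → α}
    (hb : ∃ i j, b i ≠ b j) {H : Subgroup (SpecialLinearGroup ι F)}
    (hH : ∀ (i j : ι) (hij : i ≠ j) (c : F), b i ≠ b j → transvection hij c ∈ H) : H = ⊤ := by
  obtain ⟨p, q, hpq⟩ := hb
  have : Nontrivial ι := ⟨p, q, fun h => hpq (congrArg b h)⟩
  refine subgroup_eq_top_of_transvection_mem fun i j hij c => ?_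
  by_cases hbij : b i = b j
  · obtain ⟨l, hl⟩ : ∃ l, b l ≠ b i := by
      by_contra! h
      exact hpq ((h p).trans (h q).symm)
    have hil : i ≠ l := fun h => hl (congrArg b h.symm)
    have hlj : l ≠ j := fun h => hl ((congrArg b h).trans hbij.symm)
    rw [transvection_eq_commutator hij hil hlj, commutatorElement_def]
    have h₁ := hH i l hil c hl.symm
    have h₂ := hH l j hlj 1 (hbij ▸ hl)
    exact mul_mem (mul_mem (mul_mem h₁ h₂) (inv_mem h₁)) (inv_mem h₂)
  · exact hH i j hij c hbij

end SpecialLinearGroup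

end Matrix

/-- Let `k` be a field, `n ≥ 2`, and `b : Fin n → ℕ` monotone and
non-constant.  Let `U⁺` (resp. `U⁻`) be the elements of `GLₙ(k)` of the form `1 + N` with
`N i j = 0` unless `b i < b j` (resp. unless `b j < b i`) — the unipotent radicals of a
pair of opposite proper parabolic subgroups.  Then every matrix `1 + N` of this form is
invertible of determinant `1`, and the subgroup of `GLₙ(k)` generated by `U⁺ ∪ U⁻` is
exactly `{g : det g = 1}`, i.e. `SLₙ(k)`. -/
theorem stmt9 {k : Type*} [Field k] {n : ℕ} (hn : 2 ≤ n)
    (b : Fin n → ℕ) (hb : Monotone b) (hbne : ¬ ∀ i j : Fin n, b i = b j)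
    (Uplus Uminus : Set (GL (Fin n) k))
    (hUp : ∀ g : GL (Fin n) k, g ∈ Uplus ↔ ∃ N : Matrix (Fin n) (Fin n) k,
      (∀ i j : Fin n, ¬ b i < b j → N i j = 0) ∧ (g : Matrix (Fin n) (Fin n) k) = 1 + N)
    (hUm : ∀ g : GL (Fin n) k, g ∈ Uminus ↔ ∃ N : Matrix (Fin n) (Fin n) k,
      (∀ i j : Fin n, ¬ b j < b i → N i j = 0) ∧ (g : Matrix (Fin n) (Fin n) k) = 1 + N) :
    (∀ N : Matrix (Fin n) (Fin n) k,
      ((∀ i j : Fin n, ¬ b i < b j → N i j = 0) ∨ (∀ i j : Fin n, ¬ b j < b i → N i j = 0)) →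
      IsUnit (1 + N) ∧ (1 + N).det = 1) ∧
    (∀ g : GL (Fin n) k,
      g ∈ Subgroup.closure (Uplus ∪ Uminus) ↔ (g : Matrix (Fin n) (Fin n) k).det = 1) := by
  have hdet (N : Matrix (Fin n) (Fin n) k)
      (hN : (∀ i j : Fin n, ¬ b i < b j → N i j = 0) ∨
        (∀ i j : Fin n, ¬ b j < b i → N i j = 0)) : (1 + N).det = 1 := by
    rcases hN with hN | hN
    · exact det_one_add_of_strictly_upper fun i j h => hN i j fun h' => h (hb.reflect_lt h')
    · exact det_one_add_of_strictly_lower fun i j h => hN i j fun h' => h (hb.reflect_lt h')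
  refine ⟨fun N hN => ⟨?_, hdet N hN⟩, fun g => ⟨fun hg => ?_, fun hg => ?_⟩⟩
  · rw [isUnit_iff_isUnit_det, hdet N hN]
    exact isUnit_one
  · have hle : Subgroup.closure (Uplus ∪ Uminus) ≤
        (GeneralLinearGroup.det : GL (Fin n) k →* kˣ).ker := by
      refine (Subgroup.closure_le _).2 fun u hu => Units.ext ?_
      rcases hu with hu | hu
      · obtain ⟨N, hN, huN⟩ := (hUp u).1 hu
        exact (congrArg det huN).trans (hdet N (.inl hN))
      · obtain ⟨N, hN, huN⟩ := (hUm u).1 hu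
        exact (congrArg det huN).trans (hdet N (.inr hN))
    exact congrArg Units.val (hle hg)
  · have htop : (Subgroup.closure (Uplus ∪ Uminus)).comap
        (SpecialLinearGroup.toGL : SpecialLinearGroup (Fin n) k →* GL (Fin n) k) = ⊤ := by
      refine SpecialLinearGroup.subgroup_eq_top_of_transvection_mem_of_ne (b := b)
        (by simpa using hbne) fun i j hij c hbij => Subgroup.subset_closure ?_
      have hsingle (x y : Fin n) (h : ¬ (x = i ∧ y = j)) : single i j c x y = 0 :=
        single_apply_of_ne _ _ _ _ _ fun h' => h ⟨h'.1.symm, h'.2.symm⟩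
      rcases lt_or_gt_of_ne hbij with h | h
      · refine .inl ((hUp _).2 ⟨single i j c, fun x y hxy => hsingle x y ?_, rfl⟩)
        rintro ⟨rfl, rfl⟩
        exact hxy h
      · refine .inr ((hUm _).2 ⟨single i j c, fun x y hxy => hsingle x y ?_, rfl⟩)
        rintro ⟨rfl, rfl⟩
        exact hxy h
    let g' : SpecialLinearGroup (Fin n) k := ⟨g, hg⟩
    have hg' : SpecialLinearGroup.toGL g' = g := Units.ext rfl
    rw [← hg', ← Subgroup.mem_comap, htop]
    exact Subgroup.mem_top g'
end
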